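/- Let h : D → ℝ be a discrete-time control barrier function with safe set S = {x ∈ ℝⁿ : h(x) ≤ 0} ⊆ D for the system x(k+1) = f(x(k), u(k)), and let κ : D → U satisfy κ(x) ∈ K_CBF(x) for all x ∈ D. Suppose D is positively invariant for the closed-loop map g(x) := f(x, κ(x)). Then S is an asymptotically stable set for the closed-loop system x(k+1) = g(x(k)) in D. -/

import Mathlib

open Set Metric Filter

/-- Strict sublevel sets `{h < c}` with `0 < c` are invariant along trajectories in `D`. -/
theorem iterate_lt_of_decrease {X : Type*} {D : Set X} {h d : X → ℝ} {g : X → X}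
    (hgD : MapsTo g D D)
    (hdpos : ∀ x ∈ D, ¬ h x ≤ 0 → 0 < d x)
    (hdec : ∀ x ∈ D, ¬ h x ≤ 0 → h (g x) - h x ≤ -d x)
    (hsafe : ∀ x ∈ D, h x ≤ 0 → h (g x) ≤ 0) {c : ℝ} (hc : 0 < c)
    {x : X} (hx : x ∈ D) (hxc : h x < c) (k : ℕ) : h (g^[k] x) < c := by
  induction k with
  | zero => exact hxc
  | succ k ih =>
    have hk := hgD.iterate k hx
    rw [Function.iterate_succ_apply']
    by_cases h0 : h (g^[k] x) ≤ 0
    · exact (hsafe _ hk h0).trans_lt hc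
    · linarith [hdec _ hk h0, hdpos _ hk h0]

section Lyapunov

variable {X : Type*} [MetricSpace X] {D : Set X} {h d : X → ℝ} {g : X → X}

/-- On a compact set, small values of `h` force closeness to the sublevel set `{h ≤ 0}`. -/
theorem exists_pos_forall_lt_infDist_lt (hD : IsCompact D) (hh : ContinuousOn h D)
    {ε : ℝ} (hε : 0 < ε) :
    ∃ c > (0 : ℝ), ∀ x ∈ D, h x < c → infDist x {x | h x ≤ 0} < ε := by
  have hK : IsCompact (D ∩ {x | ε ≤ infDist x {x | h x ≤ 0}}) :=
    hD.inter_right (isClosed_le continuous_const (continuous_infDist_pt _))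
  obtain ⟨c, hc, hle⟩ := hK.exists_forall_le' (hh.mono inter_subset_left) (a := 0) fun x hx => by
    by_contra hx0
    have hmem : x ∈ {x | h x ≤ 0} := not_lt.mp hx0
    exact absurd (infDist_zero_of_mem hmem) (hε.trans_le hx.2).ne'
  refine ⟨c, hc, fun x hx hxc => ?_⟩
  by_contra hcon
  exact absurd (hle x ⟨hx, not_lt.mp hcon⟩) (not_le.mpr hxc)

/-- On a compact set, closeness to the closed sublevel set `{h ≤ 0}` forces `h` to be small. -/
theorem exists_pos_forall_infDist_lt_lt (hD : IsCompact D) (hh : ContinuousOn h D)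
    (hSne : {x | h x ≤ 0}.Nonempty) (hS : IsClosed {x | h x ≤ 0}) {c : ℝ} (hc : 0 < c) :
    ∃ δ > (0 : ℝ), ∀ x ∈ D, infDist x {x | h x ≤ 0} < δ → h x < c := by
  have hK : IsCompact (D ∩ h ⁻¹' Ici c) :=
    hD.of_isClosed_subset (hh.preimage_isClosed_of_isClosed hD.isClosed isClosed_Ici)
      inter_subset_left
  obtain ⟨δ, hδ, hle⟩ := hK.exists_forall_le' (a := 0)
    (continuous_infDist_pt {x | h x ≤ 0}).continuousOn fun x hx =>
      (hS.notMem_iff_infDist_pos hSne).mp fun hx0 => absurd (hc.trans_le hx.2) (not_lt.mpr hx0)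
  refine ⟨δ, hδ, fun x hx hxδ => ?_⟩
  by_contra hcon
  exact absurd (hle x ⟨hx, not_lt.mp hcon⟩) (not_le.mpr hxδ)

/-- Every trajectory in `D` enters each sublevel set `{h < c}` with `0 < c`. -/
theorem exists_iterate_lt_of_decrease (hD : IsCompact D) (hh : ContinuousOn h D)
    (hd : ContinuousOn d D) (hgD : MapsTo g D D)
    (hdpos : ∀ x ∈ D, ¬ h x ≤ 0 → 0 < d x)
    (hdec : ∀ x ∈ D, ¬ h x ≤ 0 → h (g x) - h x ≤ -d x) {c : ℝ} (hc : 0 < c)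
    {x : X} (hx : x ∈ D) : ∃ k : ℕ, h (g^[k] x) < c := by
  by_contra! hcon
  have hK : IsCompact (D ∩ h ⁻¹' Ici c) :=
    hD.of_isClosed_subset (hh.preimage_isClosed_of_isClosed hD.isClosed isClosed_Ici)
      inter_subset_left
  obtain ⟨μ, hμ, hle⟩ := hK.exists_forall_le' (a := 0) (hd.mono inter_subset_left) fun y hy =>
    hdpos y hy.1 (not_le.mpr (hc.trans_le hy.2))
  have hbound : ∀ k : ℕ, h (g^[k] x) ≤ h x - k * μ := by
    intro k
    induction k with
    | zero => simp
    | succ k ih =>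
      have hk := hgD.iterate k hx
      rw [Function.iterate_succ_apply']
      have hstep := hdec _ hk (not_le.mpr (hc.trans_le (hcon k)))
      have hμk := hle _ ⟨hk, hcon k⟩
      push_cast
      linarith
  obtain ⟨k, hk⟩ := exists_nat_gt (h x / μ)
  rw [div_lt_iff₀ hμ] at hk
  linarith [hbound k, hcon k]

/-- Uniform stability of the sublevel set `{h ≤ 0}`. -/
theorem exists_pos_forall_iterate_infDist_lt (hD : IsCompact D) (hh : ContinuousOn h D)
    (hSne : {x | h x ≤ 0}.Nonempty) (hS : IsClosed {x | h x ≤ 0}) (hgD : MapsTo g D D)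
    (hdpos : ∀ x ∈ D, ¬ h x ≤ 0 → 0 < d x)
    (hdec : ∀ x ∈ D, ¬ h x ≤ 0 → h (g x) - h x ≤ -d x)
    (hsafe : ∀ x ∈ D, h x ≤ 0 → h (g x) ≤ 0) {ε : ℝ} (hε : 0 < ε) :
    ∃ δ > (0 : ℝ), ∀ x ∈ D, infDist x {x | h x ≤ 0} < δ →
      ∀ k : ℕ, infDist (g^[k] x) {x | h x ≤ 0} < ε := by
  obtain ⟨c, hc, hcε⟩ := exists_pos_forall_lt_infDist_lt hD hh hε
  obtain ⟨δ, hδ, hδc⟩ := exists_pos_forall_infDist_lt_lt hD hh hSne hS hc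
  exact ⟨δ, hδ, fun x hx hxδ k => hcε _ (hgD.iterate k hx)
    (iterate_lt_of_decrease hgD hdpos hdec hsafe hc hx (hδc x hx hxδ) k)⟩

/-- Every trajectory in `D` converges to the sublevel set `{h ≤ 0}`. -/
theorem tendsto_infDist_iterate_of_decrease (hD : IsCompact D) (hh : ContinuousOn h D)
    (hd : ContinuousOn d D) (hgD : MapsTo g D D)
    (hdpos : ∀ x ∈ D, ¬ h x ≤ 0 → 0 < d x)
    (hdec : ∀ x ∈ D, ¬ h x ≤ 0 → h (g x) - h x ≤ -d x)
    (hsafe : ∀ x ∈ D, h x ≤ 0 → h (g x) ≤ 0) {x : X} (hx : x ∈ D) :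
    Tendsto (fun k => infDist (g^[k] x) {x | h x ≤ 0}) atTop (nhds 0) := by
  refine Metric.tendsto_atTop.mpr fun ε hε => ?_
  obtain ⟨c, hc, hcε⟩ := exists_pos_forall_lt_infDist_lt hD hh hε
  obtain ⟨N, hN⟩ := exists_iterate_lt_of_decrease hD hh hd hgD hdpos hdec hc hx
  refine ⟨N, fun k hk => ?_⟩
  obtain ⟨j, rfl⟩ := Nat.exists_eq_add_of_le' hk
  rw [Real.dist_0_eq_abs, abs_of_nonneg infDist_nonneg]
  refine hcε _ (hgD.iterate _ hx) ?_
  rw [Function.iterate_add_apply]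
  exact iterate_lt_of_decrease hgD hdpos hdec hsafe hc (hgD.iterate N hx) hN j

end Lyapunov

/-- Let `h` be a discrete-time control barrier function on `D` with safe set
`S = {x | h x ≤ 0} ⊆ D` and decrease function `Δh`, and let `κ` be a control law with
`κ x ∈ K_CBF x` for all `x ∈ D`.  If `D` is positively invariant for the closed-loop map
`g x = f x (κ x)`, then `S` is an asymptotically stable set for the closed-loop system in `D`. -/
theorem cbf_safe_set_asymptotically_stable {n m : ℕ}
    (f : EuclideanSpace ℝ (Fin n) → EuclideanSpace ℝ (Fin m) → EuclideanSpace ℝ (Fin n))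
    (hfcont : Continuous fun p : EuclideanSpace ℝ (Fin n) × EuclideanSpace ℝ (Fin m) => f p.1 p.2)
    (U : Set (EuclideanSpace ℝ (Fin m))) (hUne : U.Nonempty) (hUcomp : IsCompact U)
    (D : Set (EuclideanSpace ℝ (Fin n))) (h : EuclideanSpace ℝ (Fin n) → ℝ)
    (hDne : D.Nonempty) (hDcomp : IsCompact D)
    (hSne : {x : EuclideanSpace ℝ (Fin n) | h x ≤ 0}.Nonempty)
    (hScomp : IsCompact {x : EuclideanSpace ℝ (Fin n) | h x ≤ 0})
    (hSD : {x : EuclideanSpace ℝ (Fin n) | h x ≤ 0} ⊆ D)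
    (hhcont : ContinuousOn h D)
    (Δh : EuclideanSpace ℝ (Fin n) → ℝ) (hΔhcont : ContinuousOn Δh D)
    (hΔhpos : ∀ x ∈ D, ¬ h x ≤ 0 → 0 < Δh x)
    (hcbf1 : ∀ x ∈ D, ¬ h x ≤ 0 → sInf ((fun u => h (f x u)) '' U) - h x ≤ -Δh x)
    (hcbf2 : ∀ x, h x ≤ 0 → sInf ((fun u => h (f x u)) '' U) ≤ 0)
    (κ : EuclideanSpace ℝ (Fin n) → EuclideanSpace ℝ (Fin m))
    (hκU : ∀ x ∈ D, κ x ∈ U)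
    (hκdec : ∀ x ∈ D, ¬ h x ≤ 0 → h (f x (κ x)) - h x ≤ -Δh x)
    (hκsafe : ∀ x ∈ D, h x ≤ 0 → h (f x (κ x)) ≤ 0)
    (hDinv : ∀ x ∈ D, f x (κ x) ∈ D) :
    ∀ x₀ ∈ D,
      (∀ ε > (0 : ℝ), ∃ δ > (0 : ℝ),
          infDist x₀ {x : EuclideanSpace ℝ (Fin n) | h x ≤ 0} < δ →
          ∀ k > 0, infDist ((fun x => f x (κ x))^[k] x₀)
            {x : EuclideanSpace ℝ (Fin n) | h x ≤ 0} < ε) ∧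
      (∃ δ' > (0 : ℝ),
          infDist x₀ {x : EuclideanSpace ℝ (Fin n) | h x ≤ 0} < δ' →
          Tendsto (fun k => infDist ((fun x => f x (κ x))^[k] x₀)
            {x : EuclideanSpace ℝ (Fin n) | h x ≤ 0}) atTop (nhds 0)) := by
  intro x₀ hx₀
  have hgD : MapsTo (fun x => f x (κ x)) D D := fun x hx => hDinv x hx
  refine ⟨fun ε hε => ?_, 1, one_pos, fun _ =>
    tendsto_infDist_iterate_of_decrease hDcomp hhcont hΔhcont hgD hΔhpos hκdec hκsafe hx₀⟩
  obtain ⟨δ, hδ, hstable⟩ := exists_pos_forall_iterate_infDist_lt hDcomp hhcont hSne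
    hScomp.isClosed hgD hΔhpos hκdec hκsafe hε
  exact ⟨δ, hδ, fun hx k _ => hstable x₀ hx₀ hx k⟩
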